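/- arXiv:1008.1469 — 2 statements merged into one kernel-verified Lean document; each statement's English description precedes it below -/
import Mathlib

section
/- For all nonnegative integers n and a, the sum over k from 0 to floor(n/4) of ((n+a+1)/(4k+a+1)) * C(5k+a, k) * C(n+a+k, 5k+a) equals the sum over k from 0 to floor(n/2) of (-1)^k * C(n+a+k, k) * C(2n+a-2k, n+a). -/
open Finset

lemma aux_coeff (p : ℕ) (hp : p ≠ 0) (f g : PowerSeries ℚ) (n : ℕ) :
    PowerSeries.coeff n (PowerSeries.expand p hp f * g) =
      ∑ k ∈ range (n / p + 1), PowerSeries.coeff k f * PowerSeries.coeff (n - p * k) g := by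
  rw [PowerSeries.coeff_mul,
    Finset.Nat.sum_antidiagonal_eq_sum_range_succ
      (fun i j => PowerSeries.coeff i (PowerSeries.expand p hp f) * PowerSeries.coeff j g)]
  symm
  have hp0 : 0 < p := Nat.pos_of_ne_zero hp
  apply Finset.sum_of_injOn (fun k => p * k)
  · intro x _ y _ h
    exact Nat.eq_of_mul_eq_mul_left hp0 h
  · intro x hx
    simp only [coe_range, Set.mem_Iio] at hx ⊢
    have h1 : x ≤ n / p := by omega
    have := (Nat.le_div_iff_mul_le hp0).1 h1
    rw [mul_comm] at this
    omega
  · intro i hi hn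
    have : ¬ p ∣ i := by
      rintro ⟨k, rfl⟩
      apply hn
      refine ⟨k, ?_, rfl⟩
      simp only [coe_range, Set.mem_Iio, mem_range] at hi ⊢
      have : k ≤ n / p := (Nat.le_div_iff_mul_le hp0).2 (by rw [mul_comm]; omega)
      omega
    rw [PowerSeries.coeff_expand_of_not_dvd _ hp _ this, zero_mul]
  · intro i _
    simp only [PowerSeries.coeff_expand_mul]

lemma aux_term (n a k : ℕ) (h : 4 * k ≤ n) :
    (((n : ℚ) + a + 1) / (4 * k + a + 1)) * ((5 * k + a).choose k) *
        ((n + a + k).choose (5 * k + a)) =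
      ((n + a + k).choose (n + a) : ℚ) * ((n + a + 1).choose (n - 4 * k)) := by
  obtain ⟨m, rfl⟩ := Nat.exists_eq_add_of_le h
  rw [Nat.cast_choose ℚ (show k ≤ 5 * k + a by omega),
    Nat.cast_choose ℚ (show 5 * k + a ≤ 4 * k + m + a + k by omega),
    Nat.cast_choose ℚ (show 4 * k + m + a ≤ 4 * k + m + a + k by omega),
    Nat.cast_choose ℚ (show 4 * k + m - 4 * k ≤ 4 * k + m + a + 1 by omega),
    show 5 * k + a - k = 4 * k + a by omega,
    show 4 * k + m + a + k - (5 * k + a) = m by omega,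
    show 4 * k + m + a + k - (4 * k + m + a) = k by omega,
    show 4 * k + m - 4 * k = m by omega,
    show 4 * k + m + a + 1 - m = 4 * k + a + 1 by omega,
    Nat.factorial_succ (4 * k + a), Nat.factorial_succ (4 * k + m + a)]
  have h1 := Nat.cast_ne_zero (R := ℚ).2 (Nat.factorial_ne_zero (5 * k + a))
  have h2 := Nat.cast_ne_zero (R := ℚ).2 (Nat.factorial_ne_zero k)
  have h3 := Nat.cast_ne_zero (R := ℚ).2 (Nat.factorial_ne_zero (4 * k + a))
  have h4 := Nat.cast_ne_zero (R := ℚ).2 (Nat.factorial_ne_zero m)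
  have h5 := Nat.cast_ne_zero (R := ℚ).2 (Nat.factorial_ne_zero (4 * k + m + a))
  have h6 : (4 * k + a + 1 : ℚ) ≠ 0 := by positivity
  push_cast
  field_simp

lemma aux_series (d : ℕ) (F : PowerSeries ℚ) (hF : F * (1 - PowerSeries.X) ^ (d + 1) = 1) :
    PowerSeries.expand 4 (by norm_num) F * (1 + PowerSeries.X) ^ (d + 1) =
      PowerSeries.expand 2 (by norm_num) (PowerSeries.rescale (-1) F) * F := by
  have h4 := congrArg (PowerSeries.expand 4 (by norm_num)) hF
  have h2 := congrArg (fun t => PowerSeries.expand 2 (by norm_num)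
    (PowerSeries.rescale (-1 : ℚ) t)) hF
  simp only [map_mul, map_pow, map_sub, map_one, PowerSeries.expand_X,
    PowerSeries.rescale_neg_one_X, map_neg] at h4 h2
  set A := PowerSeries.expand 4 (by norm_num) F
  set B := PowerSeries.expand 2 (by norm_num) (PowerSeries.rescale (-1) F)
  have e : (1 - PowerSeries.X ^ 4 : PowerSeries ℚ) ^ (d + 1) =
      (1 - PowerSeries.X) ^ (d + 1) * (1 + PowerSeries.X) ^ (d + 1) *
        (1 - -PowerSeries.X ^ 2) ^ (d + 1) := by
    rw [← mul_pow, ← mul_pow]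
    congr 1
    ring
  rw [e] at h4
  generalize (1 - PowerSeries.X : PowerSeries ℚ) ^ (d + 1) = u at *
  generalize (1 + PowerSeries.X : PowerSeries ℚ) ^ (d + 1) = v at *
  generalize (1 - -PowerSeries.X ^ 2 : PowerSeries ℚ) ^ (d + 1) = w at *
  linear_combination (-A * v) * hF - (A * v * F * u) * h2 + (B * F) * h4

theorem sun_identity_5 (n a : ℕ) :
    ∑ k ∈ range (n / 4 + 1),
      (((n : ℚ) + a + 1) / (4 * k + a + 1)) * ((5 * k + a).choose k) *
        ((n + a + k).choose (5 * k + a)) =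
    ∑ k ∈ range (n / 2 + 1),
      (-1 : ℚ) ^ k * ((n + a + k).choose k) * ((2 * n + a - 2 * k).choose (n + a)) := by
  have h := congrArg (PowerSeries.coeff n)
    (aux_series (n + a) _ (PowerSeries.mk_add_choose_mul_one_sub_pow_eq_one ℚ (n + a)))
  rw [aux_coeff, aux_coeff] at h
  convert h using 1
  · apply Finset.sum_congr rfl
    intro k hk
    rw [mem_range] at hk
    rw [aux_term n a k (by omega), PowerSeries.coeff_mk]
    congr 1
    have : ((1 + PowerSeries.X : PowerSeries ℚ)) ^ (n + a + 1) =
        (((1 + Polynomial.X) ^ (n + a + 1) : Polynomial ℚ) : PowerSeries ℚ) := by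
      simp
    rw [this, Polynomial.coeff_coe, Polynomial.coeff_one_add_X_pow]
  · apply Finset.sum_congr rfl
    intro k hk
    rw [mem_range] at hk
    rw [PowerSeries.coeff_rescale, PowerSeries.coeff_mk, PowerSeries.coeff_mk,
      show n + a + (n - 2 * k) = 2 * n + a - 2 * k by omega, Nat.choose_symm_add]
end

section
/- For all positive integers n, the sum over k from 0 to floor(n/2) of [n+k choose k+1]_{q^2} * [n choose 2k+1]_q * q^{C(n-2k-1, 2)} equals [2n choose n-1]_q, as an identity of polynomials in q. -/
open Finset

/-- The Gaussian (q-)binomial coefficient `[a choose b]_q`, defined as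
`∏_{i=1}^{b} (1 - q^(a-i+1)) / (1 - q^i)` (which is `0` when `b > a`). -/
noncomputable def qbinom (q : RatFunc ℚ) (a b : ℕ) : RatFunc ℚ :=
  ∏ i ∈ Finset.range b, (1 - q ^ ((a : ℤ) - i)) / (1 - q ^ ((i : ℤ) + 1))


section helpers

variable {q : RatFunc ℚ}

theorem qb_zero (a : ℕ) : qbinom q a 0 = 1 := by simp [qbinom]

theorem qb_succ_right (a b : ℕ) : qbinom q a (b + 1) =
    qbinom q a b * ((1 - q ^ ((a : ℤ) - b)) / (1 - q ^ ((b : ℤ) + 1))) := by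
  unfold qbinom
  rw [prod_range_succ]

theorem qb_succ_succ (a b : ℕ) : qbinom q (a + 1) (b + 1) =
    qbinom q a b * ((1 - q ^ ((a : ℤ) + 1)) / (1 - q ^ ((b : ℤ) + 1))) := by
  unfold qbinom
  rw [prod_div_distrib, prod_div_distrib, prod_range_succ', prod_range_succ, div_mul_div_comm]
  congr 2
  · apply prod_congr rfl
    intro i _
    congr 2
    push_cast
    ring

theorem qb_pascal1 (h0 : q ≠ 0) (hq : ∀ b : ℕ, 1 - q ^ ((b : ℤ) + 1) ≠ 0) (a b : ℕ) :
    qbinom q (a + 1) (b + 1) =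
      qbinom q a (b + 1) + q ^ ((a : ℤ) - b) * qbinom q a b := by
  rw [qb_succ_succ, qb_succ_right]
  have e : q ^ ((a : ℤ) + 1) = q ^ ((a : ℤ) - b) * q ^ ((b : ℤ) + 1) := by
    rw [← zpow_add₀ h0]; congr 1; ring
  rw [e]
  have := hq b
  field_simp
  ring

theorem qb_pascal2 (h0 : q ≠ 0) (hq : ∀ b : ℕ, 1 - q ^ ((b : ℤ) + 1) ≠ 0) (a b : ℕ) :
    qbinom q (a + 1) (b + 1) =
      q ^ ((b : ℤ) + 1) * qbinom q a (b + 1) + qbinom q a b := by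
  rw [qb_succ_succ, qb_succ_right]
  have e : q ^ ((a : ℤ) + 1) = q ^ ((a : ℤ) - b) * q ^ ((b : ℤ) + 1) := by
    rw [← zpow_add₀ h0]; congr 1; ring
  rw [e]
  have := hq b
  field_simp
  ring

theorem qb_self (hq : ∀ b : ℕ, 1 - q ^ ((b : ℤ) + 1) ≠ 0) (a : ℕ) : qbinom q a a = 1 := by
  induction a with
  | zero => exact qb_zero 0
  | succ a ih => rw [qb_succ_succ, ih, div_self (hq a), one_mul]

theorem qb_lt {a b : ℕ} (h : a < b) : qbinom q a b = 0 := by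
  unfold qbinom
  apply prod_eq_zero (mem_range.2 h)
  simp

theorem qb_symm (h0 : q ≠ 0) (hq : ∀ b : ℕ, 1 - q ^ ((b : ℤ) + 1) ≠ 0) (m k : ℕ) :
    qbinom q (m + k) k = qbinom q (m + k) m := by
  induction m generalizing k with
  | zero => rw [zero_add, qb_self hq, qb_zero]
  | succ m ihm =>
    induction k with
    | zero => rw [add_zero, qb_self hq, qb_zero]
    | succ k ihk =>
      rw [← add_assoc, qb_pascal1 h0 hq, qb_pascal2 h0 hq (m + 1 + k) m, ihk]
      have := ihm (k + 1)
      rw [show m + (k + 1) = m + 1 + k by ring] at this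
      rw [this]
      have e : ((m + 1 + k : ℕ) : ℤ) - k = (m : ℤ) + 1 := by push_cast; ring
      rw [e]
      ring

open PowerSeries

noncomputable def serA (q : RatFunc ℚ) (n : ℕ) : PowerSeries (RatFunc ℚ) :=
  PowerSeries.mk fun j => qbinom q n j * q ^ (j.choose 2)

noncomputable def serB (q : RatFunc ℚ) (n : ℕ) : PowerSeries (RatFunc ℚ) :=
  PowerSeries.mk fun j => qbinom q (n + j - 1) j

noncomputable def serC (q : RatFunc ℚ) (n : ℕ) : PowerSeries (RatFunc ℚ) :=
  PowerSeries.mk fun j => if Even j then qbinom q (n + j / 2 - 1) (j / 2) else 0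

theorem serA_zero : serA q 0 = 1 := by
  ext j
  rcases j with _ | j
  · simp [serA, qb_zero]
  · simp [serA, qb_lt, PowerSeries.coeff_one]

theorem serB_zero : serB q 0 = 1 := by
  ext j
  rcases j with _ | j
  · simp [serB, qb_zero]
  · simp [serB, qb_lt, PowerSeries.coeff_one]

theorem serC_zero : serC q 0 = 1 := by
  ext j
  rw [serC, coeff_mk, PowerSeries.coeff_one]
  rcases j with _ | j
  · simp [qb_zero]
  · rw [if_neg (Nat.succ_ne_zero j)]
    split_ifs with h
    · apply qb_lt
      obtain ⟨r, hr⟩ := h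
      omega
    · rfl

theorem serA_succ (h0 : q ≠ 0) (hq : ∀ b : ℕ, 1 - q ^ ((b : ℤ) + 1) ≠ 0) (n : ℕ) :
    serA q (n + 1) = serA q n * (1 + C (q ^ n) * X) := by
  ext j
  rw [mul_add, mul_one, mul_left_comm, map_add, coeff_C_mul]
  rcases j with _ | j
  · simp [serA, qb_zero]
  · rw [coeff_succ_mul_X]
    simp only [serA, coeff_mk]
    rw [qb_pascal1 h0 hq, Nat.choose_succ_left j 2 (by norm_num)]
    have e : q ^ n = q ^ ((n : ℤ) - j) * q ^ j := by
      rw [← zpow_natCast, ← zpow_natCast, ← zpow_add₀ h0]; congr 1; ring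
    rw [e]
    simp [pow_add]
    ring

theorem serB_succ (h0 : q ≠ 0) (hq : ∀ b : ℕ, 1 - q ^ ((b : ℤ) + 1) ≠ 0) (n : ℕ) :
    serB q (n + 1) * (1 - C (q ^ n) * X) = serB q n := by
  ext j
  rw [mul_sub, mul_one, mul_left_comm, map_sub, coeff_C_mul]
  rcases j with _ | j
  · simp [serB, qb_zero]
  · rw [coeff_succ_mul_X]
    simp only [serB, coeff_mk]
    rw [show n + 1 + (j + 1) - 1 = n + j + 1 by omega, show n + 1 + j - 1 = n + j by omega,
      show n + (j + 1) - 1 = n + j by omega, qb_pascal1 h0 hq]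
    have e : ((n + j : ℕ) : ℤ) - j = n := by push_cast; ring
    rw [e, zpow_natCast]
    ring

theorem serC_succ (h0 : q ≠ 0) (hq : ∀ b : ℕ, 1 - q ^ ((b : ℤ) + 1) ≠ 0) (n : ℕ) :
    serC q (n + 1) * (1 - C (q ^ n) * X ^ 2) = serC q n := by
  ext j
  rw [mul_sub, mul_one, mul_left_comm, map_sub, coeff_C_mul]
  rw [coeff_mul_X_pow']
  simp only [serC, coeff_mk]
  rcases Nat.even_or_odd j with ⟨r, hr⟩ | h
  · rcases r with _ | r
    · subst hr
      simp [qb_zero]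
    · have hj : 2 ≤ j := by omega
      have e1 : Even j := ⟨r + 1, hr⟩
      have e2 : Even (j - 2) := ⟨r, by omega⟩
      rw [if_pos hj, if_pos e1, if_pos e1, if_pos e2]
      rw [show j / 2 = r + 1 by omega, show (j - 2) / 2 = r by omega,
        show n + 1 + (r + 1) - 1 = n + r + 1 by omega, show n + 1 + r - 1 = n + r by omega,
        show n + (r + 1) - 1 = n + r by omega, qb_pascal1 h0 hq]
      have e : ((n + r : ℕ) : ℤ) - r = n := by push_cast; ring
      rw [e, zpow_natCast]
      ring
  · have h1 : ¬ Even j := by simpa using h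
    have h2 : 2 ≤ j → ¬ Even (j - 2) := by
      rintro hj ⟨r, hr⟩
      exact h1 ⟨r + 1, by omega⟩
    rw [if_neg h1, if_neg h1]
    split_ifs with h3 h4
    · exact absurd h4 (h2 h3)
    · simp
    · simp

theorem serAC (h0 : q ≠ 0) (hq : ∀ b : ℕ, 1 - q ^ ((b : ℤ) + 1) ≠ 0)
    (h0' : q ^ 2 ≠ 0) (hq' : ∀ b : ℕ, 1 - (q ^ 2) ^ ((b : ℤ) + 1) ≠ 0) (n : ℕ) :
    serA q n * serC (q ^ 2) n = serB q n := by
  induction n with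
  | zero => rw [serA_zero, serB_zero, serC_zero, one_mul]
  | succ n ih =>
    have hne : (1 - C (q ^ n) * X : PowerSeries (RatFunc ℚ)) ≠ 0 := by
      intro h
      have := congrArg (coeff 0) h
      simp at this
    apply mul_right_cancel₀ hne
    rw [serB_succ h0 hq, ← ih, serA_succ h0 hq, ← serC_succ h0' hq' n]
    have e : (C ((q ^ 2) ^ n) : PowerSeries (RatFunc ℚ)) = C (q ^ n) * C (q ^ n) := by
      rw [← map_mul]; congr 1; ring
    rw [e]
    ring

end helpers

theorem X_pow_ne_one (m : ℕ) (hm : 0 < m) : (1 : RatFunc ℚ) - RatFunc.X ^ m ≠ 0 := by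
  intro h
  have h1 : (algebraMap (Polynomial ℚ) (RatFunc ℚ)) (Polynomial.X ^ m)
      = algebraMap (Polynomial ℚ) (RatFunc ℚ) 1 := by
    rw [map_pow, RatFunc.algebraMap_X, map_one]
    exact (sub_eq_zero.1 h).symm
  have h2 := RatFunc.algebraMap_injective ℚ h1
  have h3 := congrArg Polynomial.natDegree h2
  simp at h3
  omega

theorem q_sun_special2 (n : ℕ) (hn : 0 < n) :
    ∑ k ∈ range (n / 2 + 1),
      qbinom (RatFunc.X ^ 2) (n + k) (k + 1) * qbinom RatFunc.X n (2 * k + 1) *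
        RatFunc.X ^ ((n - 2 * k - 1).choose 2) =
    qbinom RatFunc.X (2 * n) (n - 1) := by
  have h0 : (RatFunc.X : RatFunc ℚ) ≠ 0 := RatFunc.X_ne_zero
  have hq : ∀ b : ℕ, 1 - (RatFunc.X : RatFunc ℚ) ^ ((b : ℤ) + 1) ≠ 0 := by
    intro b
    have := X_pow_ne_one (b + 1) (by omega)
    exact_mod_cast this
  have hq' : ∀ b : ℕ, 1 - ((RatFunc.X : RatFunc ℚ) ^ 2) ^ ((b : ℤ) + 1) ≠ 0 := by
    intro b
    have := X_pow_ne_one (2 * (b + 1)) (by omega)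
    rw [pow_mul] at this
    exact_mod_cast this
  have key := congrArg (PowerSeries.coeff (n + 1)) (serAC h0 hq (pow_ne_zero 2 h0) hq' n)
  rw [PowerSeries.coeff_mul] at key
  simp only [serA, serB, serC, PowerSeries.coeff_mk] at key
  have hR : qbinom (RatFunc.X : RatFunc ℚ) (2 * n) (n - 1)
      = qbinom RatFunc.X (n + (n + 1) - 1) (n + 1) := by
    have := qb_symm h0 hq (n + 1) (n - 1)
    rw [show n + 1 + (n - 1) = 2 * n by omega] at this
    rw [this, show n + (n + 1) - 1 = 2 * n by omega]
  rw [hR, ← key]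
  have hsub : range ((n + 1) / 2) ⊆ range (n / 2 + 1) := by
    intro k
    simp only [mem_range]
    omega
  rw [← sum_subset hsub]
  · apply sum_of_injOn (fun k => (n - 2 * k - 1, 2 * k + 2))
    · intro a _ b _ h
      simp only [Prod.mk.injEq] at h
      omega
    · intro k hk
      simp only [coe_range, Set.mem_Iio] at hk
      simp only [mem_coe, HasAntidiagonal.mem_antidiagonal]
      omega
    · rintro ⟨i, j⟩ hij hn'
      simp only [HasAntidiagonal.mem_antidiagonal] at hij
      simp only
      split_ifs with he
      · obtain ⟨r, hr⟩ := he
        rcases r with _ | r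
        · rw [qb_lt (by omega)]
          simp
        · exfalso
          apply hn'
          refine ⟨r, ?_, ?_⟩
          · simp only [coe_range, Set.mem_Iio]
            omega
          · simp only [Prod.mk.injEq]
            omega
      · simp
    · intro k hk
      simp only [mem_range] at hk
      simp only
      rw [if_pos ⟨k + 1, by ring⟩, show (2 * k + 2) / 2 = k + 1 by omega,
        show n + (k + 1) - 1 = n + k by omega]
      have := qb_symm h0 hq (n - 2 * k - 1) (2 * k + 1)
      rw [show n - 2 * k - 1 + (2 * k + 1) = n by omega] at this
      rw [this]
      ring
  · intro k _ hk
    simp only [mem_range] at hk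
    rw [qb_lt (a := n) (by omega)]
    simp
end
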